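/- If Ψ is the pure state on the terminal Hilbert space obtained by projecting the non-terminal factors of a state Ω onto arbitrary pure states, then for any subset A of terminals, rank(Ψ_A) ≤ min over S with S ∩ T = A of rank(Ω_S), where Ψ_A and Ω_S denote reduced density matrices. -/

import Mathlib

section

variable {V : Type*} [Fintype V] [DecidableEq V] (D : V → ℕ)

/-- Combine assignments on a subset `T` and on its complement into an assignment on `V`. -/
def mergeIdx (T : Finset V) (f : ∀ x : {x // x ∈ T}, Fin (D x))
    (h : ∀ x : {x // x ∉ T}, Fin (D x)) : ∀ x : V, Fin (D x) :=
  fun x => if hx : x ∈ T then f ⟨x, hx⟩ else h ⟨x, hx⟩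

/-- The reduced density matrix on the factors in `S` of the pure state `v` on `⨂_{x∈V} H_x`,
obtained by tracing out the factors outside `S`. -/
noncomputable def reducedMat (S : Finset V) (v : (∀ x : V, Fin (D x)) → ℂ) :
    Matrix (∀ x : {x // x ∈ S}, Fin (D x)) (∀ x : {x // x ∈ S}, Fin (D x)) ℂ :=
  fun f g => ∑ h : ∀ x : {x // x ∉ S}, Fin (D x),
    v (mergeIdx D S f h) * star (v (mergeIdx D S g h))

/-- The reduced density matrix on `A ⊆ T` of a pure state `w` on the terminal factors
`⨂_{x∈T} H_x`, obtained by tracing out the factors in `T \ A`. -/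
noncomputable def reducedMatT (T A : Finset V)
    (w : (∀ x : {x // x ∈ T}, Fin (D x)) → ℂ) :
    Matrix (∀ x : {x // x ∈ A}, Fin (D x)) (∀ x : {x // x ∈ A}, Fin (D x)) ℂ :=
  fun f g => ∑ h : ∀ x : {x // x ∈ T \ A}, Fin (D x),
    w (fun x => if hx : x.1 ∈ A then f ⟨x.1, hx⟩
        else h ⟨x.1, Finset.mem_sdiff.mpr ⟨x.2, hx⟩⟩) *
      star (w (fun x => if hx : x.1 ∈ A then g ⟨x.1, hx⟩
        else h ⟨x.1, Finset.mem_sdiff.mpr ⟨x.2, hx⟩⟩))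

theorem sum_mergeIdx (S : Finset V) (F : (∀ x : V, Fin (D x)) → ℂ) :
    ∑ f, ∑ h, F (mergeIdx D S f h) = ∑ g, F g := by
  rw [← Fintype.sum_prod_type' (f := fun f h => F (mergeIdx D S f h))]
  exact (Equiv.piEquivPiSubtypeProd (fun x => x ∈ S) (fun x => Fin (D x))).symm.sum_comp F

theorem prod_mergeIdx (S : Finset V) (W : ∀ x : V, Fin (D x) → ℂ)
    (f : ∀ x : {x // x ∈ S}, Fin (D x)) (h : ∀ x : {x // x ∉ S}, Fin (D x)) :
    ∏ x, W x (mergeIdx D S f h x) = (∏ x, W x.1 (f x)) * ∏ x, W x.1 (h x) := by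
  rw [← Fintype.prod_subtype_mul_prod_subtype (fun x => x ∈ S)]
  congr 1 <;> refine Finset.prod_congr (by ext; simp) fun x _ => ?_
  · simp [mergeIdx]
  · simp [mergeIdx, dif_neg x.2]

/-- The coefficient at `x` of the product functional that evaluates the terminal factors at the
assignment `f` and projects each non-terminal factor onto `φ x`. -/
noncomputable def projWeight (T : Finset V) (φ : ∀ x : {x // x ∉ T}, Fin (D x) → ℂ)
    (f : ∀ x : {x // x ∈ T}, Fin (D x)) (x : V) (i : Fin (D x)) : ℂ :=
  if hx : x ∈ T then if i = f ⟨x, hx⟩ then 1 else 0 else star (φ ⟨x, hx⟩ i)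

theorem sum_projWeight (T : Finset V) (Ω : (∀ x : V, Fin (D x)) → ℂ)
    (φ : ∀ x : {x // x ∉ T}, Fin (D x) → ℂ) (f : ∀ x : {x // x ∈ T}, Fin (D x)) :
    ∑ g, (∏ x, projWeight D T φ f x (g x)) * Ω g =
      ∑ h : ∀ x : {x // x ∉ T}, Fin (D x),
        (∏ x, star (φ x (h x))) * Ω (mergeIdx D T f h) := by
  rw [← sum_mergeIdx D T, Finset.sum_eq_single f]
  · refine Finset.sum_congr rfl fun h _ => ?_
    rw [prod_mergeIdx, Finset.prod_eq_one fun x _ => by simp [projWeight], one_mul]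
    congr 1
    exact Finset.prod_congr rfl fun x _ => dif_neg x.2
  · intro f' _ hf'
    obtain ⟨x, hx⟩ := Function.ne_iff.mp hf'
    refine Finset.sum_eq_zero fun h _ => ?_
    rw [prod_mergeIdx, Finset.prod_eq_zero (Finset.mem_univ x), zero_mul, zero_mul]
    simp [projWeight, hx]
  · simp

/-- The coefficient matrix of a state on `V` across the cut `S`. -/
def cutMat (S : Finset V) (v : (∀ x : V, Fin (D x)) → ℂ) :
    Matrix (∀ x : {x // x ∈ S}, Fin (D x)) (∀ x : {x // x ∉ S}, Fin (D x)) ℂ :=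
  fun f h => v (mergeIdx D S f h)

/-- Combine assignments on `A` and on `T \ A` into an assignment on `T`. -/
def mergeIdxT (T A : Finset V) (f : ∀ x : {x // x ∈ A}, Fin (D x))
    (h : ∀ x : {x // x ∈ T \ A}, Fin (D x)) : ∀ x : {x // x ∈ T}, Fin (D x) :=
  fun x => if hx : x.1 ∈ A then f ⟨x.1, hx⟩ else h ⟨x.1, Finset.mem_sdiff.mpr ⟨x.2, hx⟩⟩

/-- The coefficient matrix of a state on the terminals `T` across the cut `A`. -/
def cutMatT (T A : Finset V) (w : (∀ x : {x // x ∈ T}, Fin (D x)) → ℂ) :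
    Matrix (∀ x : {x // x ∈ A}, Fin (D x)) (∀ x : {x // x ∈ T \ A}, Fin (D x)) ℂ :=
  fun f h => w (mergeIdxT D T A f h)

open scoped ComplexOrder in
theorem rank_reducedMat (S : Finset V) (v : (∀ x : V, Fin (D x)) → ℂ) :
    (reducedMat D S v).rank = (cutMat D S v).rank :=
  Matrix.rank_self_mul_conjTranspose (cutMat D S v)

open scoped ComplexOrder in
theorem rank_reducedMatT (T A : Finset V) (w : (∀ x : {x // x ∈ T}, Fin (D x)) → ℂ) :
    (reducedMatT D T A w).rank = (cutMatT D T A w).rank :=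
  Matrix.rank_self_mul_conjTranspose (cutMatT D T A w)

theorem prod_projWeight_mergeIdxT (T : Finset V) (φ : ∀ x : {x // x ∉ T}, Fin (D x) → ℂ)
    (S : Finset V) (f : ∀ x : {x // x ∈ S ∩ T}, Fin (D x))
    (h : ∀ x : {x // x ∈ T \ (S ∩ T)}, Fin (D x)) (a : ∀ x : {x // x ∈ S}, Fin (D x))
    (b : ∀ x : {x // x ∉ S}, Fin (D x)) :
    ∏ x, projWeight D T φ (mergeIdxT D T (S ∩ T) f h) x (mergeIdx D S a b x) =
      (∏ x : {x // x ∈ S}, if hx : x.1 ∈ T then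
        if a x = f ⟨x.1, Finset.mem_inter.mpr ⟨x.2, hx⟩⟩ then 1 else 0
        else star (φ ⟨x.1, hx⟩ (a x))) *
      ∏ x : {x // x ∉ S}, if hx : x.1 ∈ T then
        if b x = h ⟨x.1, Finset.mem_sdiff.mpr ⟨hx, fun hm => x.2 (Finset.mem_inter.mp hm).1⟩⟩
        then 1 else 0
        else star (φ ⟨x.1, hx⟩ (b x)) := by
  rw [prod_mergeIdx]
  congr 1 <;> refine Finset.prod_congr rfl fun x _ => ?_ <;> by_cases hx : x.1 ∈ T <;>
    simp [projWeight, mergeIdxT, hx, x.2]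

/-- If `Ψ` is obtained from a pure state `Ω` by projecting the non-terminal factors onto
pure states `φ_x`, then for any `A ⊆ T`, `rank(Ψ_A) ≤ rank(Ω_S)` for every cut `S` with
`S ∩ T = A`; that is, `rank(Ψ_A) ≤ min_{S : S ∩ T = A} rank(Ω_S)`. -/
theorem rank_reduced_projected_le_mincut (T : Finset V)
    (Ω : (∀ x : V, Fin (D x)) → ℂ)
    (hΩ : ∑ f, Ω f * star (Ω f) = 1)
    (φ : ∀ x : {x // x ∉ T}, Fin (D x) → ℂ)
    (hφ : ∀ x, ∑ i, φ x i * star (φ x i) = 1)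
    (Ψ : (∀ x : {x // x ∈ T}, Fin (D x)) → ℂ)
    (hΨ : ∀ f, Ψ f = ∑ h : ∀ x : {x // x ∉ T}, Fin (D x),
      (∏ x, star (φ x (h x))) * Ω (mergeIdx D T f h))
    (A : Finset V) (hA : A ⊆ T)
    (S : Finset V) (hS : S ∩ T = A) :
    (reducedMatT D T A Ψ).rank ≤ (reducedMat D S Ω).rank := by
  subst hS
  rw [rank_reducedMat, rank_reducedMatT]
  let L : Matrix (∀ x : {x // x ∈ S ∩ T}, Fin (D x)) (∀ x : {x // x ∈ S}, Fin (D x)) ℂ :=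
    fun f a => ∏ x : {x // x ∈ S}, if hx : x.1 ∈ T then
      if a x = f ⟨x.1, Finset.mem_inter.mpr ⟨x.2, hx⟩⟩ then 1 else 0
      else star (φ ⟨x.1, hx⟩ (a x))
  let R : Matrix (∀ x : {x // x ∉ S}, Fin (D x)) (∀ x : {x // x ∈ T \ (S ∩ T)}, Fin (D x)) ℂ :=
    fun b h => ∏ x : {x // x ∉ S}, if hx : x.1 ∈ T then
      if b x = h ⟨x.1, Finset.mem_sdiff.mpr ⟨hx, fun hm => x.2 (Finset.mem_inter.mp hm).1⟩⟩
      then 1 else 0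
      else star (φ ⟨x.1, hx⟩ (b x))
  have factorization : cutMatT D T (S ∩ T) Ψ = L * (cutMat D S Ω * R) := by
    ext f h
    simp only [cutMatT, hΨ, ← sum_projWeight, ← sum_mergeIdx D S, prod_projWeight_mergeIdxT,
      Matrix.mul_apply, Finset.mul_sum]
    refine Finset.sum_congr rfl fun a _ => Finset.sum_congr rfl fun b _ => ?_
    simp only [L, R, cutMat]
    ring
  rw [factorization]
  exact (Matrix.rank_mul_le_right _ _).trans (Matrix.rank_mul_le_left _ _)

end
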